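/- Assume p ≠ 2 and let l ∈ F_q^× be a non-square. Every singular pair x = (A,B) of ternary quadratic forms over F_q (i.e. Disc(x) = 0) either (D) is G-equivalent to a pair with A = 0 (A and B linearly dependent), or (C) is G-equivalent to a pair lying in the subspace of pairs of forms both of which involve only monomials uw, vw, w^2 (A and B share a common linear factor), or (B) is G-equivalent to a pair of quadratic forms in the two variables v, w only, or is G-equivalent to exactly one of the six elements (w^2, uw + v^2), (vw, uw + v^2), (w^2, u^2 − v^2), (w^2, u^2 − l v^2), (v^2 − w^2, uw), (v^2 − l w^2, uw). -/

import Mathlib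

open scoped Classical
open MvPolynomial Matrix

noncomputable section

/-- The standard additive character `t ↦ exp(2πi·Tr_{F/F_p}(t)/p)` of a finite field `F`
of characteristic `p`. -/
def psiF (p : ℕ) [Fact p.Prime] (F : Type*) [Field F] [Fintype F] [CharP F p] (t : F) : ℂ :=
  letI : Algebra (ZMod p) F := ZMod.algebra F p
  Complex.exp (2 * Real.pi * Complex.I * ((Algebra.trace (ZMod p) F t).val : ℂ) / (p : ℂ))

variable {F : Type*} [Field F] [Fintype F]

/-- The ternary quadratic form `a u² + b uv + c uw + d v² + e vw + f w²`
attached to `(a,b,c,d,e,f)`. -/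
def TQ (c : Fin 6 → F) : MvPolynomial (Fin 3) F :=
  C (c 0) * X 0 ^ 2 + C (c 1) * X 0 * X 1 + C (c 2) * X 0 * X 2 +
    C (c 3) * X 1 ^ 2 + C (c 4) * X 1 * X 2 + C (c 5) * X 2 ^ 2

/-- Substitution corresponding to the linear change of variables `(u,v,w) ↦ (u,v,w)·g`. -/
def subst3 (g : Matrix (Fin 3) (Fin 3) F) (P : MvPolynomial (Fin 3) F) : MvPolynomial (Fin 3) F :=
  aeval (fun j => ∑ i : Fin 3, C (g i j) * X i) P

/-- The action of `GL₂(F) × GL₃(F)` on pairs of ternary quadratic forms: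
`(g₁,g₂)∘(A,B) = (α g₂Ag₂ᵀ + β g₂Bg₂ᵀ, γ g₂Ag₂ᵀ + δ g₂Bg₂ᵀ)` for `g₁ = [[α,β],[γ,δ]]`,
written at the level of the associated quadratic forms. -/
def pairActT (g₁ : Matrix.GeneralLinearGroup (Fin 2) F)
    (g₂ : Matrix.GeneralLinearGroup (Fin 3) F)
    (PQ : MvPolynomial (Fin 3) F × MvPolynomial (Fin 3) F) :
    MvPolynomial (Fin 3) F × MvPolynomial (Fin 3) F :=
  (C ((g₁ : Matrix (Fin 2) (Fin 2) F) 0 0) * subst3 (g₂ : Matrix (Fin 3) (Fin 3) F) PQ.1 +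
     C ((g₁ : Matrix (Fin 2) (Fin 2) F) 0 1) * subst3 (g₂ : Matrix (Fin 3) (Fin 3) F) PQ.2,
   C ((g₁ : Matrix (Fin 2) (Fin 2) F) 1 0) * subst3 (g₂ : Matrix (Fin 3) (Fin 3) F) PQ.1 +
     C ((g₁ : Matrix (Fin 2) (Fin 2) F) 1 1) * subst3 (g₂ : Matrix (Fin 3) (Fin 3) F) PQ.2)

/-- `x` lies in the `GL₂(F) × GL₃(F)`-orbit of `r` (pairs of ternary quadratic forms). -/
def InOrbitPT (r x : (Fin 6 → F) × (Fin 6 → F)) : Prop :=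
  ∃ (g₁ : Matrix.GeneralLinearGroup (Fin 2) F) (g₂ : Matrix.GeneralLinearGroup (Fin 3) F),
    pairActT g₁ g₂ (TQ r.1, TQ r.2) = (TQ x.1, TQ x.2)

/-- The symmetric 3×3 matrix attached to the ternary quadratic form `(a,b,c,d,e,f)`. -/
def gram3 (x : Fin 6 → F) : Matrix (Fin 3) (Fin 3) F :=
  !![x 0, x 1 / 2, x 2 / 2; x 1 / 2, x 3, x 4 / 2; x 2 / 2, x 4 / 2, x 5]

/-- The cubic resolvent `r_x(u,v) = -4 det(Au + Bv)` of a pair `x = (A,B)` of ternary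
quadratic forms, a binary cubic form in the variables `u = X 0`, `v = X 1`. -/
def resolventPT (x : (Fin 6 → F) × (Fin 6 → F)) : MvPolynomial (Fin 2) F :=
  (-4 : MvPolynomial (Fin 2) F) *
    (Matrix.of fun i j => C (gram3 x.1 i j) * X 0 + C (gram3 x.2 i j) * X 1).det

/-- Discriminant of the binary cubic form `a u³ + b u²v + c uv² + d v³`. -/
def discCubic (a b c d : F) : F :=
  b^2*c^2 + 18*a*b*c*d - 4*a*c^3 - 4*b^3*d - 27*a^2*d^2

/-- `Disc(x) = disc(r_x)` for a pair of ternary quadratic forms. -/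
def DiscPT (x : (Fin 6 → F) × (Fin 6 → F)) : F :=
  discCubic
    (coeff (Finsupp.single 0 3) (resolventPT x))
    (coeff (Finsupp.single 0 2 + Finsupp.single 1 1) (resolventPT x))
    (coeff (Finsupp.single 0 1 + Finsupp.single 1 2) (resolventPT x))
    (coeff (Finsupp.single 1 3) (resolventPT x))

variable {K : Type*} [Field K]

/-- The symmetric matrix `[[a,b,c],[b,d,e],[c,e,f]]`. -/
def sym3 (a b c d e f : K) : Matrix (Fin 3) (Fin 3) K := !![a, b, c; b, d, e; c, e, f]

/-- The coefficients of the quadratic form with Gram matrix `S`. -/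
def formOfGram (S : Matrix (Fin 3) (Fin 3) K) : Fin 6 → K :=
  ![S 0 0, 2 * S 0 1, 2 * S 0 2, S 1 1, 2 * S 1 2, S 2 2]

theorem exists_eq_sym3 {R : Type*} {S : Matrix (Fin 3) (Fin 3) R} (hS : Sᵀ = S) :
    ∃ a b c d e f, S = sym3 a b c d e f := by
  have h : ∀ i j, S j i = S i j := fun i j => by
    conv_rhs => rw [← hS]
    rfl
  refine ⟨S 0 0, S 0 1, S 0 2, S 1 1, S 1 2, S 2 2, ?_⟩
  ext i j
  fin_cases i <;> fin_cases j <;> simp [sym3, h 0 1, h 0 2, h 1 2]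

theorem gram3_transpose (c : Fin 6 → K) : (gram3 c)ᵀ = gram3 c := by
  ext i j
  fin_cases i <;> fin_cases j <;> simp [gram3]

theorem formOfGram_gram3 (h2 : (2 : K) ≠ 0) (c : Fin 6 → K) : formOfGram (gram3 c) = c := by
  ext i
  fin_cases i <;> simp [gram3, formOfGram] <;> field_simp

theorem gram3_formOfGram (h2 : (2 : K) ≠ 0) {S : Matrix (Fin 3) (Fin 3) K} (hS : Sᵀ = S) :
    gram3 (formOfGram S) = S := by
  obtain ⟨a, b, c, d, e, f, rfl⟩ := exists_eq_sym3 hS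
  ext i j
  fin_cases i <;> fin_cases j <;> simp [gram3, formOfGram, sym3] <;> field_simp

theorem TQ_injective : Function.Injective (TQ : (Fin 6 → K) → MvPolynomial (Fin 3) K) := by
  intro c d h
  have ev : ∀ v : Fin 3 → K, eval v (TQ c) = eval v (TQ d) := fun v => by rw [h]
  have h0 := ev ![1, 0, 0]
  have h3 := ev ![0, 1, 0]
  have h5 := ev ![0, 0, 1]
  have h1 := ev ![1, 1, 0]
  have h2 := ev ![1, 0, 1]
  have h4 := ev ![0, 1, 1]
  simp [TQ] at h0 h1 h2 h3 h4 h5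
  ext i
  fin_cases i <;> simp <;> grind

theorem TQ_add_smul (s t : K) (A B : Matrix (Fin 3) (Fin 3) K) :
    C s * TQ (formOfGram A) + C t * TQ (formOfGram B) = TQ (formOfGram (s • A + t • B)) := by
  simp [TQ, formOfGram]
  ring

theorem subst3_TQ (g : Matrix (Fin 3) (Fin 3) K) {S : Matrix (Fin 3) (Fin 3) K} (hS : Sᵀ = S) :
    subst3 g (TQ (formOfGram S)) = TQ (formOfGram (g * S * gᵀ)) := by
  obtain ⟨a, b, c, d, e, f, rfl⟩ := exists_eq_sym3 hS
  simp [TQ, formOfGram, subst3, sym3, Fin.sum_univ_three, Matrix.mul_apply, algebraMap_eq,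
    show (C 2 : MvPolynomial (Fin 3) K) = 2 from map_ofNat C 2, map_ofNat]
  ring

/-- Equivalence of pairs of matrices under change of generators of the pencil and congruence. -/
def PencilEquiv (A B A' B' : Matrix (Fin 3) (Fin 3) K) : Prop :=
  ∃ (α β γ δ : K) (g : Matrix (Fin 3) (Fin 3) K), α * δ - β * γ ≠ 0 ∧ g.det ≠ 0 ∧
    A' = α • (g * A * gᵀ) + β • (g * B * gᵀ) ∧ B' = γ • (g * A * gᵀ) + δ • (g * B * gᵀ)

namespace PencilEquiv

variable {A B A' B' A'' B'' : Matrix (Fin 3) (Fin 3) K}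

theorem refl (A B : Matrix (Fin 3) (Fin 3) K) : PencilEquiv A B A B :=
  ⟨1, 0, 0, 1, 1, by simp, by simp, by simp, by simp⟩

theorem trans (h : PencilEquiv A B A' B') (h' : PencilEquiv A' B' A'' B'') :
    PencilEquiv A B A'' B'' := by
  obtain ⟨α, β, γ, δ, g, hM, hg, rfl, rfl⟩ := h
  obtain ⟨α', β', γ', δ', g', hM', hg', rfl, rfl⟩ := h'
  refine ⟨α' * α + β' * γ, α' * β + β' * δ, γ' * α + δ' * γ, γ' * β + δ' * δ, g' * g, ?_, ?_, ?_, ?_⟩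
  · have := mul_ne_zero hM' hM
    intro h
    apply this
    linear_combination h
  · rw [det_mul]
    exact mul_ne_zero hg' hg
  all_goals
    simp only [transpose_mul, Matrix.mul_add, Matrix.add_mul, Matrix.mul_smul, Matrix.smul_mul,
      Matrix.mul_assoc]
    module

theorem symm (h : PencilEquiv A B A' B') : PencilEquiv A' B' A B := by
  obtain ⟨α, β, γ, δ, g, hM, hg, rfl, rfl⟩ := h
  have hu : IsUnit g.det := isUnit_iff_ne_zero.2 hg
  have key : ∀ S : Matrix (Fin 3) (Fin 3) K, g⁻¹ * (g * S * gᵀ) * (g⁻¹)ᵀ = S := fun S => by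
    have h1 : gᵀ * (g⁻¹)ᵀ = 1 := by
      rw [← transpose_mul, Matrix.nonsing_inv_mul g hu, transpose_one]
    calc g⁻¹ * (g * S * gᵀ) * (g⁻¹)ᵀ = (g⁻¹ * g) * S * (gᵀ * (g⁻¹)ᵀ) := by
          simp only [Matrix.mul_assoc]
      _ = S := by rw [h1, Matrix.nonsing_inv_mul g hu, Matrix.one_mul, Matrix.mul_one]
  obtain ⟨Δ, hΔ⟩ : ∃ Δ, Δ = α * δ - β * γ := ⟨_, rfl⟩
  rw [← hΔ] at hM
  refine ⟨δ / Δ, -β / Δ, -γ / Δ, α / Δ, g⁻¹, ?_, ?_, ?_, ?_⟩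
  · have : δ / Δ * (α / Δ) - -β / Δ * (-γ / Δ) = Δ⁻¹ := by
      field_simp
      rw [hΔ]
      ring
    rw [this]
    exact inv_ne_zero hM
  · rw [det_nonsing_inv, Ring.inverse_eq_inv']
    exact inv_ne_zero hg
  all_goals
    simp only [Matrix.mul_add, Matrix.add_mul, Matrix.mul_smul, Matrix.smul_mul, key]
    ext i j
    simp only [Matrix.add_apply, Matrix.smul_apply, smul_eq_mul]
    field_simp
    rw [hΔ]
    ring

theorem transpose_eq (h : PencilEquiv A B A' B') (hA : Aᵀ = A) (hB : Bᵀ = B) :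
    A'ᵀ = A' ∧ B'ᵀ = B' := by
  obtain ⟨α, β, γ, δ, g, -, -, rfl, rfl⟩ := h
  simp [transpose_mul, hA, hB, Matrix.mul_assoc]

theorem det_pencil (h : PencilEquiv A B A' B') : ∃ α β γ δ D : K, α * δ - β * γ ≠ 0 ∧ D ≠ 0 ∧
    (∃ g : Matrix (Fin 3) (Fin 3) K, A' = α • (g * A * gᵀ) + β • (g * B * gᵀ)) ∧
    ∀ x y : K, (x • A' + y • B').det =
      D ^ 2 * ((α * x + γ * y) • A + (β * x + δ * y) • B).det := by
  obtain ⟨α, β, γ, δ, g, hM, hg, rfl, rfl⟩ := h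
  refine ⟨α, β, γ, δ, g.det, hM, hg, ⟨g, rfl⟩, fun x y => ?_⟩
  have : x • (α • (g * A * gᵀ) + β • (g * B * gᵀ)) + y • (γ • (g * A * gᵀ) + δ • (g * B * gᵀ)) =
      g * ((α * x + γ * y) • A + (β * x + δ * y) • B) * gᵀ := by
    simp only [Matrix.mul_add, Matrix.add_mul, Matrix.mul_smul, Matrix.smul_mul]
    module
  rw [this, det_mul, det_mul, det_transpose]
  ring

end PencilEquiv

theorem inOrbitPT_iff (h2 : (2 : K) ≠ 0) (r x : (Fin 6 → K) × (Fin 6 → K)) :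
    InOrbitPT r x ↔ PencilEquiv (gram3 r.1) (gram3 r.2) (gram3 x.1) (gram3 x.2) := by
  have key : ∀ (α β : K) (g : Matrix (Fin 3) (Fin 3) K) (z : Fin 6 → K),
      C α * subst3 g (TQ r.1) + C β * subst3 g (TQ r.2) = TQ z ↔
        gram3 z = α • (g * gram3 r.1 * gᵀ) + β • (g * gram3 r.2 * gᵀ) := by
    intro α β g z
    have hs : (α • (g * gram3 r.1 * gᵀ) + β • (g * gram3 r.2 * gᵀ))ᵀ =
        α • (g * gram3 r.1 * gᵀ) + β • (g * gram3 r.2 * gᵀ) := by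
      simp [transpose_mul, gram3_transpose, Matrix.mul_assoc]
    rw [← formOfGram_gram3 h2 r.1, ← formOfGram_gram3 h2 r.2, subst3_TQ g (gram3_transpose _),
      subst3_TQ g (gram3_transpose _), TQ_add_smul, formOfGram_gram3 h2, formOfGram_gram3 h2,
      TQ_injective.eq_iff]
    constructor
    · rintro rfl
      exact gram3_formOfGram h2 hs
    · intro h
      rw [← h, formOfGram_gram3 h2]
  constructor
  · rintro ⟨g₁, g₂, h⟩
    rw [pairActT, Prod.mk.injEq, key, key] at h
    refine ⟨_, _, _, _, _, ?_, ?_, h.1, h.2⟩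
    · rw [← det_fin_two]
      exact g₁.isUnit.map detMonoidHom |>.ne_zero
    · exact g₂.isUnit.map detMonoidHom |>.ne_zero
  · rintro ⟨α, β, γ, δ, g, hM, hg, h⟩
    refine ⟨GeneralLinearGroup.mkOfDetNeZero !![α, β; γ, δ] (by simpa [det_fin_two] using hM),
      GeneralLinearGroup.mkOfDetNeZero g hg, ?_⟩
    rw [pairActT, Prod.mk.injEq, key, key]
    simpa [GeneralLinearGroup.mkOfDetNeZero] using h

/-- The coefficient of `x² y` in `det (x A + y B)`. -/
def mixedDet (A B : Matrix (Fin 3) (Fin 3) K) : K := (adjugate A * B).trace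

theorem det_smul_add_smul (A B : Matrix (Fin 3) (Fin 3) K) (s t : K) :
    (s • A + t • B).det =
      A.det * s ^ 3 + mixedDet A B * s ^ 2 * t + mixedDet B A * s * t ^ 2 + B.det * t ^ 3 := by
  simp only [mixedDet, det_fin_three, adjugate_fin_three, trace_fin_three, Matrix.mul_apply,
    Fin.sum_univ_three, Matrix.add_apply, Matrix.smul_apply, smul_eq_mul, of_apply, cons_val]
  ring

theorem mixedDet_smul_add_smul (A B : Matrix (Fin 3) (Fin 3) K) (s t s' t' : K) :
    mixedDet (s • A + t • B) (s' • A + t' • B) =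
      s' * (3 * A.det * s ^ 2 + 2 * mixedDet A B * s * t + mixedDet B A * t ^ 2) +
      t' * (mixedDet A B * s ^ 2 + 2 * mixedDet B A * s * t + 3 * B.det * t ^ 2) := by
  simp only [mixedDet, det_fin_three, adjugate_fin_three, trace_fin_three, Matrix.mul_apply,
    Fin.sum_univ_three, Matrix.add_apply, Matrix.smul_apply, smul_eq_mul, of_apply, cons_val]
  ring

theorem mixedDet_congr (A B g : Matrix (Fin 3) (Fin 3) K) :
    mixedDet (g * A * gᵀ) (g * B * gᵀ) = g.det ^ 2 * mixedDet A B := by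
  have h : adjugate (g * A * gᵀ) * (g * B * gᵀ) =
      g.det • (adjugate gᵀ * (adjugate A * B * gᵀ)) := by
    rw [adjugate_mul_distrib, adjugate_mul_distrib]
    calc adjugate gᵀ * (adjugate A * adjugate g) * (g * B * gᵀ)
        = adjugate gᵀ * (adjugate A * (adjugate g * g) * B * gᵀ) := by
          simp only [Matrix.mul_assoc]
      _ = _ := by
          rw [adjugate_mul, Matrix.mul_smul, Matrix.mul_one]
          simp only [Matrix.mul_smul, Matrix.smul_mul]
  rw [mixedDet, h, trace_smul, trace_mul_comm, Matrix.mul_assoc, mul_adjugate, det_transpose,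
    Matrix.mul_smul, Matrix.mul_one, trace_smul, mixedDet, smul_eq_mul, smul_eq_mul]
  ring

theorem resolventPT_eq (x : (Fin 6 → K) × (Fin 6 → K)) :
    resolventPT x =
      monomial (Finsupp.single 0 3) (-4 * (gram3 x.1).det) +
      monomial (Finsupp.single 0 2 + Finsupp.single 1 1) (-4 * mixedDet (gram3 x.1) (gram3 x.2)) +
      monomial (Finsupp.single 0 1 + Finsupp.single 1 2) (-4 * mixedDet (gram3 x.2) (gram3 x.1)) +
      monomial (Finsupp.single 1 3) (-4 * (gram3 x.2).det) := by
  have hm : ∀ (i j : ℕ) (r : K), monomial (Finsupp.single (0 : Fin 2) i + Finsupp.single 1 j) r =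
      C r * X 0 ^ i * X 1 ^ j := fun i j r => by
    rw [X_pow_eq_monomial, X_pow_eq_monomial, mul_assoc, monomial_mul, C_mul_monomial]
    simp
  have h0 := hm 3 0 (-4 * (gram3 x.1).det)
  have h3 := hm 0 3 (-4 * (gram3 x.2).det)
  rw [Finsupp.single_zero, add_zero] at h0
  rw [Finsupp.single_zero, zero_add] at h3
  rw [h0, h3, hm, hm, resolventPT]
  generalize gram3 x.1 = A
  generalize gram3 x.2 = B
  simp only [mixedDet, det_fin_three, adjugate_fin_three, trace_fin_three, Matrix.mul_apply,
    Fin.sum_univ_three, of_apply, cons_val, map_add, map_sub, map_mul, map_neg,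
    show (C 4 : MvPolynomial (Fin 2) K) = 4 from map_ofNat C 4]
  ring

theorem discCubic_eq_zero_of_DiscPT (h2 : (2 : K) ≠ 0) {x : (Fin 6 → K) × (Fin 6 → K)}
    (hx : DiscPT x = 0) :
    discCubic (gram3 x.1).det (mixedDet (gram3 x.1) (gram3 x.2))
      (mixedDet (gram3 x.2) (gram3 x.1)) (gram3 x.2).det = 0 := by
  have ne : ∀ {i j i' j' : ℕ}, i ≠ i' → (Finsupp.single (0 : Fin 2) i + Finsupp.single 1 j) ≠
      Finsupp.single (0 : Fin 2) i' + Finsupp.single 1 j' := fun {i j i' j'} h he => by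
    apply h
    simpa using DFunLike.congr_fun he 0
  have e0 : (Finsupp.single (0 : Fin 2) 3 : Fin 2 →₀ ℕ) =
      Finsupp.single 0 3 + Finsupp.single 1 0 := by simp
  have e3 : (Finsupp.single (1 : Fin 2) 3 : Fin 2 →₀ ℕ) =
      Finsupp.single 0 0 + Finsupp.single 1 3 := by simp
  rw [DiscPT, resolventPT_eq, e0, e3] at hx
  simp only [coeff_add, coeff_monomial, if_true,
    if_neg (ne (show 3 ≠ 2 by decide)), if_neg (ne (show 3 ≠ 1 by decide)),
    if_neg (ne (show 3 ≠ 0 by decide)), if_neg (ne (show 2 ≠ 3 by decide)),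
    if_neg (ne (show 2 ≠ 1 by decide)), if_neg (ne (show 2 ≠ 0 by decide)),
    if_neg (ne (show 1 ≠ 3 by decide)), if_neg (ne (show 1 ≠ 2 by decide)),
    if_neg (ne (show 1 ≠ 0 by decide)), if_neg (ne (show 0 ≠ 3 by decide)),
    if_neg (ne (show 0 ≠ 2 by decide)), if_neg (ne (show 0 ≠ 1 by decide)),
    add_zero, zero_add] at hx
  refine (mul_eq_zero.1 (?_ : (2 : K) ^ 8 * _ = 0)).resolve_left (pow_ne_zero _ h2)
  rw [← hx, discCubic, discCubic]
  ring

theorem exists_double_root (h2 : (2 : F) ≠ 0) {a b c d : F} (h : discCubic a b c d = 0) :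
    ∃ s t : F, (s ≠ 0 ∨ t ≠ 0) ∧
      a * s ^ 3 + b * s ^ 2 * t + c * s * t ^ 2 + d * t ^ 3 = 0 ∧
      3 * a * s ^ 2 + 2 * b * s * t + c * t ^ 2 = 0 ∧
      b * s ^ 2 + 2 * c * s * t + 3 * d * t ^ 2 = 0 := by
  rw [discCubic] at h
  by_cases ha : a = 0
  · subst ha
    by_cases hb : b = 0
    · exact ⟨1, 0, by simp, by simp, by simp, by simp [hb]⟩
    · have h' : c ^ 2 - 4 * b * d = 0 := by
        have : b ^ 2 * (c ^ 2 - 4 * b * d) = 0 := by linear_combination h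
        exact (mul_eq_zero.1 this).resolve_left (pow_ne_zero _ hb)
      refine ⟨-c, 2 * b, Or.inr (mul_ne_zero h2 hb), ?_, by ring, ?_⟩
      · linear_combination (-2 * b ^ 2) * h'
      · linear_combination (-3 * b) * h'
  by_cases hP : b ^ 2 - 3 * a * c = 0
  · have hQ : b * c - 9 * a * d = 0 := by
      refine pow_eq_zero_iff two_ne_zero |>.1 ?_
      linear_combination (-3) * h + 4 * (c ^ 2 - 3 * b * d) * hP
    by_cases h3 : (3 : F) = 0
    · have hb : b = 0 := by
        refine pow_eq_zero_iff two_ne_zero |>.1 ?_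
        linear_combination hP + a * c * h3
      subst hb
      have hc : c = 0 := by
        refine pow_eq_zero_iff three_ne_zero |>.1 ?_
        have : 2 ^ 2 * a * c ^ 3 = 0 := by linear_combination -h - 9 * a ^ 2 * d ^ 2 * h3
        exact (mul_eq_zero.1 this).resolve_left (mul_ne_zero (pow_ne_zero _ h2) ha)
      subst hc
      have inj : Function.Injective (fun x : F => x ^ 3) := by
        intro x y hxy
        have hxy' : x ^ 3 = y ^ 3 := hxy
        refine sub_eq_zero.1 (pow_eq_zero_iff three_ne_zero |>.1 ?_)
        linear_combination hxy' + (x * y ^ 2 - x ^ 2 * y) * h3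
      obtain ⟨s, hs⟩ := Finite.surjective_of_injective inj (-d / a)
      have hs' : s ^ 3 = -d / a := hs
      refine ⟨s, 1, by simp, ?_, ?_, ?_⟩
      · rw [hs']
        field_simp
        ring
      · linear_combination a * s ^ 2 * h3
      · linear_combination d * h3
    · refine ⟨-b, 3 * a, Or.inr (mul_ne_zero h3 ha), ?_, ?_, ?_⟩
      · linear_combination (2 * a * b) * hP - 3 * a ^ 2 * hQ
      · linear_combination (-3 * a) * hP
      · linear_combination b * hP - 3 * a * hQ
  · refine ⟨9 * a * d - b * c, 2 * (b ^ 2 - 3 * a * c), Or.inr (mul_ne_zero h2 hP), ?_, ?_, ?_⟩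
    · linear_combination (-2 * b ^ 3 + 9 * a * b * c - 27 * a ^ 2 * d) * h
    · linear_combination (-9 * a) * h
    · linear_combination (-3 * b) * h

/-- Every singular pencil is equivalent to one whose first member is a double root of the
determinant form. -/
theorem exists_pencilEquiv_double_root (h2 : (2 : F) ≠ 0) (A B : Matrix (Fin 3) (Fin 3) F)
    (h : discCubic A.det (mixedDet A B) (mixedDet B A) B.det = 0) :
    ∃ A' B', PencilEquiv A B A' B' ∧ A'.det = 0 ∧ mixedDet A' B' = 0 := by
  obtain ⟨s, t, hst, h0, hs, ht⟩ := exists_double_root h2 h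
  obtain ⟨s', t', hM⟩ : ∃ s' t' : F, s * t' - t * s' ≠ 0 := by
    rcases hst with hs | ht
    · exact ⟨0, 1, by simpa using hs⟩
    · exact ⟨-1, 0, by simpa using ht⟩
  refine ⟨s • A + t • B, s' • A + t' • B, ⟨s, t, s', t', 1, hM, by simp, by simp, by simp⟩, ?_, ?_⟩
  · rw [det_smul_add_smul, h0]
  · rw [mixedDet_smul_add_smul, hs, ht]
    ring

theorem sym3_congr (p q r s t u v w x a b c d e f : K) :
    !![p, q, r; s, t, u; v, w, x] * sym3 a b c d e f * !![p, q, r; s, t, u; v, w, x]ᵀ =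
      sym3 (a * p ^ 2 + d * q ^ 2 + f * r ^ 2 + 2 * (b * p * q + c * p * r + e * q * r))
        (a * p * s + d * q * t + f * r * u + b * (p * t + q * s) + c * (p * u + r * s) +
          e * (q * u + r * t))
        (a * p * v + d * q * w + f * r * x + b * (p * w + q * v) + c * (p * x + r * v) +
          e * (q * x + r * w))
        (a * s ^ 2 + d * t ^ 2 + f * u ^ 2 + 2 * (b * s * t + c * s * u + e * t * u))
        (a * s * v + d * t * w + f * u * x + b * (s * w + t * v) + c * (s * x + u * v) +
          e * (t * x + u * w))
        (a * v ^ 2 + d * w ^ 2 + f * x ^ 2 + 2 * (b * v * w + c * v * x + e * w * x)) := by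
  ext i j
  fin_cases i <;> fin_cases j <;> simp [sym3, Matrix.mul_apply, Fin.sum_univ_three] <;> ring

theorem smul_sym3_add_smul_sym3 (m n a b c d e f a' b' c' d' e' f' : K) :
    m • sym3 a b c d e f + n • sym3 a' b' c' d' e' f' =
      sym3 (m * a + n * a') (m * b + n * b') (m * c + n * c') (m * d + n * d') (m * e + n * e')
        (m * f + n * f') := by
  ext i j
  fin_cases i <;> fin_cases j <;> simp [sym3]

theorem det_rows (p q r s t u v w x : K) : (!![p, q, r; s, t, u; v, w, x]).det =
    p * (t * x - u * w) - q * (s * x - u * v) + r * (s * w - t * v) := by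
  simp [det_fin_three]
  ring

theorem sym3_zero : sym3 0 0 0 0 0 0 = (0 : Matrix (Fin 3) (Fin 3) K) := by
  ext i j
  fin_cases i <;> fin_cases j <;> rfl

theorem det_sym3 (a b c d e f : K) :
    (sym3 a b c d e f).det = a * (d * f - e ^ 2) - b * (b * f - e * c) + c * (b * e - d * c) := by
  rw [sym3, det_rows]
  ring

/-- The six representatives of singular pairs without common factor or common vertex. -/
def singularRep (l : K) : Fin 6 → (Fin 6 → K) × (Fin 6 → K) :=
  ![(![0,0,0,0,0,1], ![0,0,1,1,0,0]), (![0,0,0,0,1,0], ![0,0,1,1,0,0]),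
    (![0,0,0,0,0,1], ![1,0,0,-1,0,0]), (![0,0,0,0,0,1], ![1,0,0,-l,0,0]),
    (![0,0,0,1,0,-1], ![0,0,1,0,0,0]), (![0,0,0,1,0,-l], ![0,0,1,0,0,0])]

/-- The first and second members of the Gram matrices of `singularRep`. -/
def singularGram (l : K) :
    Fin 6 → Matrix (Fin 3) (Fin 3) K × Matrix (Fin 3) (Fin 3) K :=
  ![(sym3 0 0 0 0 0 1, sym3 0 0 (1 / 2) 1 0 0), (sym3 0 0 0 0 (1 / 2) 0, sym3 0 0 (1 / 2) 1 0 0),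
    (sym3 0 0 0 0 0 1, sym3 1 0 0 (-1) 0 0), (sym3 0 0 0 0 0 1, sym3 1 0 0 (-l) 0 0),
    (sym3 0 0 0 1 0 (-1), sym3 0 0 (1 / 2) 0 0 0), (sym3 0 0 0 1 0 (-l), sym3 0 0 (1 / 2) 0 0 0)]

theorem gram3_singularRep (l : K) (i : Fin 6) :
    (gram3 (singularRep l i).1, gram3 (singularRep l i).2) = singularGram l i := by
  fin_cases i <;> simp [singularRep, singularGram, gram3, sym3]

/-- The pair is equivalent to one of the normal forms of singular pairs. -/
def HasSingularForm (l : K) (A B : Matrix (Fin 3) (Fin 3) K) : Prop :=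
  (∃ B', PencilEquiv A B 0 B') ∨
  (∃ c e f c' e' f', PencilEquiv A B (sym3 0 0 c 0 e f) (sym3 0 0 c' 0 e' f')) ∨
  (∃ d e f d' e' f', PencilEquiv A B (sym3 0 0 0 d e f) (sym3 0 0 0 d' e' f')) ∨
  ∃ i, PencilEquiv A B (singularGram l i).1 (singularGram l i).2

theorem PencilEquiv.hasSingularForm {l : K} {A B A' B' : Matrix (Fin 3) (Fin 3) K}
    (h : PencilEquiv A B A' B') (h' : HasSingularForm l A' B') : HasSingularForm l A B := by
  rcases h' with ⟨_, h'⟩ | ⟨_, _, _, _, _, _, h'⟩ | ⟨_, _, _, _, _, _, h'⟩ | ⟨i, h'⟩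
  · exact Or.inl ⟨_, h.trans h'⟩
  · exact Or.inr (Or.inl ⟨_, _, _, _, _, _, h.trans h'⟩)
  · exact Or.inr (Or.inr (Or.inl ⟨_, _, _, _, _, _, h.trans h'⟩))
  · exact Or.inr (Or.inr (Or.inr ⟨i, h.trans h'⟩))

/-- A binary quadratic form in odd characteristic can be diagonalised. -/
theorem exists_binary_orthogonal (h2 : (2 : K) ≠ 0) (d e f : K) :
    ∃ p q r s : K, p * s - q * r ≠ 0 ∧ d * p * r + e * (p * s + q * r) + f * q * s = 0 := by
  by_cases hd : d = 0
  · by_cases hf : f = 0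
    · refine ⟨1, 1, 1, -1, ?_, ?_⟩
      · intro h
        apply h2
        linear_combination -h
      · rw [hd, hf]
        ring
    · exact ⟨f, -e, 0, 1, by simpa using hf, by ring⟩
  · exact ⟨1, 0, -e, d, by simpa using hd, by ring⟩

/-- The shape of a double line and a conic tangent to it. -/
theorem hasSingularForm_of_double_line_tangent (h2 : (2 : K) ≠ 0) (l c : K) {d : K} (hd : d ≠ 0)
    (e f : K) : HasSingularForm l (sym3 0 0 0 0 0 1) (sym3 0 0 c d e f) := by
  by_cases hc : c = 0
  · subst hc
    exact Or.inr (Or.inr (Or.inl ⟨_, _, _, _, _, _, PencilEquiv.refl _ _⟩))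
  · refine Or.inr (Or.inr (Or.inr ⟨0, ?_⟩))
    refine ⟨1, 0, (e ^ 2 / d - f) / d, 1 / d, !![d / (2 * c), 0, 0; 0, 1, 0; 0, -e / d, 1],
      ?_, ?_, ?_, ?_⟩
    · simp [hd]
    · simp [det_rows, hd, hc, h2]
    all_goals
      simp only [sym3_congr, smul_sym3_add_smul_sym3]
      simp only [singularGram, cons_val]
      congr 1 <;> field_simp <;> ring

/-- The shape of a double line and a conic transversal to it. -/
theorem hasSingularForm_of_double_line_transversal {l : K}
    (hl : ∀ t : K, t ≠ 0 → ∃ s, s ≠ 0 ∧ (t = s ^ 2 ∨ t = l * s ^ 2)) {a d : K} (ha : a ≠ 0)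
    (hd : d ≠ 0) (c e f : K) : HasSingularForm l (sym3 0 0 0 0 0 1) (sym3 a 0 c d e f) := by
  obtain ⟨s, hs, hsd⟩ := hl (-d / a) (div_ne_zero (neg_ne_zero.2 hd) ha)
  have normalise : ∀ m : K, -d / a = m * s ^ 2 →
      PencilEquiv (sym3 0 0 0 0 0 1) (sym3 a 0 c d e f)
        (sym3 0 0 0 0 0 1) (sym3 1 0 0 (-m) 0 0) := by
    intro m hm
    have hm' : m = -d / (a * s ^ 2) := by
      field_simp at hm ⊢
      linear_combination -hm
    refine ⟨1, 0, (c ^ 2 / a + e ^ 2 / d - f) / a, 1 / a,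
      !![1, 0, 0; 0, 1 / s, 0; -c / a, -e / d, 1], ?_, ?_, ?_, ?_⟩
    · simp [ha]
    · simp [det_rows, hs]
    all_goals
      rw [sym3_congr, sym3_congr, smul_sym3_add_smul_sym3]
      congr 1
      all_goals
        try rw [hm']
        field_simp
        try ring
  rcases hsd with hsd | hsd
  · exact Or.inr (Or.inr (Or.inr ⟨2, normalise 1 (by rw [hsd, one_mul])⟩))
  · exact Or.inr (Or.inr (Or.inr ⟨3, normalise l hsd⟩))

theorem hasSingularForm_of_double_line (h2 : (2 : K) ≠ 0) {l : K}
    (hl : ∀ t : K, t ≠ 0 → ∃ s, s ≠ 0 ∧ (t = s ^ 2 ∨ t = l * s ^ 2)) (a b c d e f : K) :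
    HasSingularForm l (sym3 0 0 0 0 0 1) (sym3 a b c d e f) := by
  have diagonal : ∀ a c d e f : K,
      HasSingularForm l (sym3 0 0 0 0 0 1) (sym3 a 0 c d e f) := by
    intro a c d e f
    by_cases ha : a = 0
    · subst ha
      by_cases hd : d = 0
      · subst hd
        exact Or.inr (Or.inl ⟨_, _, _, _, _, _, PencilEquiv.refl _ _⟩)
      · exact hasSingularForm_of_double_line_tangent h2 l c hd e f
    by_cases hd : d = 0
    · subst hd
      refine PencilEquiv.hasSingularForm ?_ (hasSingularForm_of_double_line_tangent h2 l e ha c f)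
      refine ⟨1, 0, 0, 1, !![0, 1, 0; 1, 0, 0; 0, 0, 1], by simp, by simp [det_rows], ?_, ?_⟩
      all_goals
        simp only [sym3_congr, smul_sym3_add_smul_sym3]
        congr 1 <;> ring
    · exact hasSingularForm_of_double_line_transversal hl ha hd c e f
  obtain ⟨p, q, r, s, hdet, horth⟩ := exists_binary_orthogonal h2 a b d
  have step : PencilEquiv (sym3 0 0 0 0 0 1) (sym3 a b c d e f) (sym3 0 0 0 0 0 1)
      (sym3 (a * p ^ 2 + 2 * b * p * q + d * q ^ 2) 0 (c * p + e * q)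
        (a * r ^ 2 + 2 * b * r * s + d * s ^ 2) (c * r + e * s) f) := by
    refine ⟨1, 0, 0, 1, !![p, q, 0; r, s, 0; 0, 0, 1], by simp, ?_, ?_, ?_⟩
    · rw [det_rows]
      convert hdet using 1
      ring
    · simp only [sym3_congr, smul_sym3_add_smul_sym3]
      congr 1 <;> ring
    · simp only [sym3_congr, smul_sym3_add_smul_sym3]
      congr 1 <;> first | ring1 | linear_combination -horth
  exact step.hasSingularForm (diagonal _ _ _ _ _)

/-- The shape of a pair of lines `v w = 0` and a conic through its vertex tangent to one of
them. -/
theorem hasSingularForm_of_line_pair_tangent (h2 : (2 : K) ≠ 0) (l : K) {k r : K} (hk : k ≠ 0)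
    (hr : r ≠ 0) (x y z : K) : HasSingularForm l (sym3 0 0 0 0 k 0) (sym3 0 0 r x y z) := by
  by_cases hx : x = 0
  · subst hx
    exact Or.inr (Or.inl ⟨_, _, _, _, _, _, PencilEquiv.refl _ _⟩)
  · refine Or.inr (Or.inr (Or.inr ⟨1, 1 / (2 * k), 0, -y / (k * x), 1 / x,
      !![x / (2 * r), 0, 0; 0, 1, 0; -z / (2 * r), 0, 1], ?_, ?_, ?_, ?_⟩))
    · simp [h2, hk, hx]
    · simp [det_rows, h2, hr, hx]
    all_goals
      simp only [sym3_congr, smul_sym3_add_smul_sym3]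
      simp only [singularGram, cons_val]
      congr 1 <;> field_simp <;> ring

/-- The shape of a pair of lines and a conic through its vertex tangent to none of them. -/
theorem hasSingularForm_of_line_pair_transversal (h2 : (2 : K) ≠ 0) {l : K}
    (hl : ∀ t : K, t ≠ 0 → ∃ s, s ≠ 0 ∧ (t = s ^ 2 ∨ t = l * s ^ 2)) {q r : K} (hq : q ≠ 0)
    (hr : r ≠ 0) (x y z : K) :
    HasSingularForm l (sym3 0 0 0 r 0 (r * q)) (sym3 0 0 r x y z) := by
  obtain ⟨s, hs, hsd⟩ := hl (-q) (neg_ne_zero.2 hq)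
  have normalise : ∀ t : K, -q = t * s ^ 2 →
      PencilEquiv (sym3 0 0 0 r 0 (r * q)) (sym3 0 0 r x y z)
        (sym3 0 0 0 1 0 (-t)) (sym3 0 0 (1 / 2) 0 0 0) := by
    intro t ht
    obtain rfl : q = -(t * s ^ 2) := by linear_combination -ht
    refine ⟨1 / r, 0, -x / r, 1, !![s / (2 * r), 0, 0; -y / r, 1, 0;
      (-z - x * t * s ^ 2) / (2 * r * s), 0, 1 / s], ?_, ?_, ?_, ?_⟩
    · simp [hr]
    · simp [det_rows, hs, hr, h2]
    all_goals
      simp only [sym3_congr, smul_sym3_add_smul_sym3]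
      congr 1 <;> field_simp <;> ring
  rcases hsd with hsd | hsd
  · exact Or.inr (Or.inr (Or.inr ⟨4, normalise 1 (by rw [hsd, one_mul])⟩))
  · exact Or.inr (Or.inr (Or.inr ⟨5, normalise l hsd⟩))

theorem hasSingularForm_of_line_pair (h2 : (2 : K) ≠ 0) {l : K}
    (hl : ∀ t : K, t ≠ 0 → ∃ s, s ≠ 0 ∧ (t = s ^ 2 ∨ t = l * s ^ 2)) {m n : K} (hm : m ≠ 0)
    (hn : n ≠ 0) (b c d e f : K) :
    HasSingularForm l (sym3 0 0 0 m 0 n) (sym3 0 b c d e f) := by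
  by_cases hbc : b = 0 ∧ c = 0
  · obtain ⟨rfl, rfl⟩ := hbc
    exact Or.inr (Or.inr (Or.inl ⟨_, _, _, _, _, _, PencilEquiv.refl _ _⟩))
  by_cases hN : m * c ^ 2 + n * b ^ 2 = 0
  · have hb : b ≠ 0 := by
      rintro rfl
      simp [hm] at hN
      exact hbc ⟨rfl, hN⟩
    have hc : c ≠ 0 := by
      rintro rfl
      simp [hn] at hN
      exact hb hN
    have h2bc : 2 * (b * c) ≠ 0 := mul_ne_zero h2 (mul_ne_zero hb hc)
    have hk : m * c ^ 2 - n * b ^ 2 ≠ 0 := by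
      intro h
      have : 2 * (m * c ^ 2) = 0 := by linear_combination h + hN
      simp [h2, hm, hc] at this
    refine PencilEquiv.hasSingularForm ?_ (hasSingularForm_of_line_pair_tangent h2 l hk h2bc
      (d * c ^ 2 - 2 * e * b * c + f * b ^ 2) (d * c ^ 2 - f * b ^ 2)
      (d * c ^ 2 + 2 * e * b * c + f * b ^ 2))
    refine ⟨1, 0, 0, 1, !![1, 0, 0; 0, c, -b; 0, c, b], by simp, ?_, ?_, ?_⟩
    · rw [det_rows]
      convert h2bc using 1
      ring
    · simp only [sym3_congr, smul_sym3_add_smul_sym3]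
      congr 1 <;> first | ring1 | linear_combination -hN
    · simp only [sym3_congr, smul_sym3_add_smul_sym3]
      congr 1 <;> ring1
  · refine PencilEquiv.hasSingularForm ?_ (hasSingularForm_of_line_pair_transversal h2 hl
      (mul_ne_zero hm hn) hN (d * c ^ 2 - 2 * e * b * c + f * b ^ 2)
      (d * n * b * c - f * m * b * c + e * (m * c ^ 2 - n * b ^ 2))
      (d * n ^ 2 * b ^ 2 + f * m ^ 2 * c ^ 2 + 2 * e * m * n * b * c))
    refine ⟨1, 0, 0, 1, !![1, 0, 0; 0, c, -b; 0, n * b, m * c], by simp, ?_, ?_, ?_⟩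
    · rw [det_rows]
      convert hN using 1
      ring
    all_goals
      simp only [sym3_congr, smul_sym3_add_smul_sym3]
      congr 1 <;> ring1

theorem hasSingularForm_of_diagonal (h2 : (2 : K) ≠ 0) {l : K}
    (hl : ∀ t : K, t ≠ 0 → ∃ s, s ≠ 0 ∧ (t = s ^ 2 ∨ t = l * s ^ 2)) (m n a b c d e f : K)
    (hmix : m * n * a = 0) :
    HasSingularForm l (sym3 0 0 0 m 0 n) (sym3 a b c d e f) := by
  have plane : ∀ n a b c d e f : K, HasSingularForm l (sym3 0 0 0 0 0 n) (sym3 a b c d e f) := by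
    intro n a b c d e f
    by_cases hn : n = 0
    · subst hn
      rw [sym3_zero]
      exact Or.inl ⟨_, PencilEquiv.refl _ _⟩
    · refine PencilEquiv.hasSingularForm ?_ (hasSingularForm_of_double_line h2 hl a b c d e f)
      refine ⟨1 / n, 0, 0, 1, 1, by simpa using hn, by simp, ?_, by simp⟩
      simp [sym3, hn]
  by_cases hm : m = 0
  · subst hm
    exact plane n a b c d e f
  by_cases hn : n = 0
  · subst hn
    refine PencilEquiv.hasSingularForm ?_ (plane m a c b f e d)
    refine ⟨1, 0, 0, 1, !![1, 0, 0; 0, 0, 1; 0, 1, 0], by simp, by simp [det_rows], ?_, ?_⟩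
    all_goals
      simp only [sym3_congr, smul_sym3_add_smul_sym3]
      congr 1 <;> ring1
  · have ha : a = 0 := by simpa [hm, hn] using hmix
    subst ha
    exact hasSingularForm_of_line_pair h2 hl hm hn b c d e f

theorem hasSingularForm_of_double_root (h2 : (2 : K) ≠ 0) {l : K}
    (hl : ∀ t : K, t ≠ 0 → ∃ s, s ≠ 0 ∧ (t = s ^ 2 ∨ t = l * s ^ 2))
    {A B : Matrix (Fin 3) (Fin 3) K} (hA : Aᵀ = A) (hB : Bᵀ = B) (hdet : A.det = 0)
    (hmix : mixedDet A B = 0) : HasSingularForm l A B := by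
  obtain ⟨v, hv, hvA⟩ := exists_vecMul_eq_zero_iff.2 hdet
  obtain ⟨g, hg, hrow⟩ : ∃ g : Matrix (Fin 3) (Fin 3) K, g.det ≠ 0 ∧ g 0 = v := by
    have hv' : v = ![v 0, v 1, v 2] := by
      ext i
      fin_cases i <;> rfl
    by_cases h0 : v 0 = 0
    · by_cases h1 : v 1 = 0
      · have h2 : v 2 ≠ 0 := by
          intro h2
          apply hv
          rw [hv', h0, h1, h2]
          ext i
          fin_cases i <;> rfl
        exact ⟨!![v 0, v 1, v 2; 1, 0, 0; 0, 1, 0], by simp [det_rows, h2], hv'.symm⟩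
      · exact ⟨!![v 0, v 1, v 2; 1, 0, 0; 0, 0, 1], by simp [det_rows, h1], hv'.symm⟩
    · exact ⟨!![v 0, v 1, v 2; 0, 1, 0; 0, 0, 1], by simp [det_rows, h0], hv'.symm⟩
  have step : PencilEquiv A B (g * A * gᵀ) (g * B * gᵀ) :=
    ⟨1, 0, 0, 1, g, by simp, hg, by simp, by simp⟩
  obtain ⟨hA', hB'⟩ := step.transpose_eq hA hB
  have hmix' : mixedDet (g * A * gᵀ) (g * B * gᵀ) = 0 := by
    rw [mixedDet_congr, hmix, mul_zero]
  have hker : ∀ j, (g * A * gᵀ) 0 j = 0 := fun j => by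
    rw [Matrix.mul_assoc, mul_apply_eq_vecMul, hrow, ← vecMul_vecMul, hvA, zero_vecMul,
      Pi.zero_apply]
  refine step.hasSingularForm ?_
  obtain ⟨a, b, c, d, e, f, hS⟩ := exists_eq_sym3 hA'
  obtain ⟨a', b', c', d', e', f', hT⟩ := exists_eq_sym3 hB'
  rw [hS] at hker
  rw [hS, hT] at hmix' ⊢
  obtain rfl : a = 0 := hker 0
  obtain rfl : b = 0 := hker 1
  obtain rfl : c = 0 := hker 2
  obtain ⟨p, q, r, s, hpq, horth⟩ := exists_binary_orthogonal h2 d e f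
  have step' : PencilEquiv (sym3 0 0 0 d e f) (sym3 a' b' c' d' e' f')
      (sym3 0 0 0 (d * p ^ 2 + 2 * e * p * q + f * q ^ 2) 0
        (d * r ^ 2 + 2 * e * r * s + f * s ^ 2))
      (sym3 a' (b' * p + c' * q) (b' * r + c' * s)
        (d' * p ^ 2 + 2 * e' * p * q + f' * q ^ 2)
        (d' * p * r + e' * (p * s + q * r) + f' * q * s)
        (d' * r ^ 2 + 2 * e' * r * s + f' * s ^ 2)) := by
    refine ⟨1, 0, 0, 1, !![1, 0, 0; 0, p, q; 0, r, s], by simp, ?_, ?_, ?_⟩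
    · simpa [det_rows] using hpq
    · simp only [sym3_congr, smul_sym3_add_smul_sym3]
      congr 1 <;> first | ring1 | linear_combination -horth
    · simp only [sym3_congr, smul_sym3_add_smul_sym3]
      congr 1 <;> ring1
  refine step'.hasSingularForm (hasSingularForm_of_diagonal h2 hl _ _ _ _ _ _ _ _ ?_)
  have hdisc : (d * f - e ^ 2) * a' = 0 := by
    rw [← hmix']
    simp only [mixedDet, sym3, adjugate_fin_three, trace_fin_three, Matrix.mul_apply,
      Fin.sum_univ_three, of_apply, cons_val]
    ring
  linear_combination (p * s - q * r) ^ 2 * hdisc +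
    (d * p * r + e * (p * s + q * r) + f * q * s) * a' * horth

theorem det_pencil_singularGram (h2 : (2 : K) ≠ 0) (l : K) :
    (∀ i ∈ ({0, 1} : Set (Fin 6)), ∀ x y : K,
      (x • (singularGram l i).1 + y • (singularGram l i).2).det = -(1 / 4) * y ^ 3) ∧
    (∀ i ∈ ({2, 3, 4, 5} : Set (Fin 6)), ∀ x y : K,
      (x • (singularGram l i).1 + y • (singularGram l i).2).det =
        ![0, 0, -1, -l, -(1 / 4), -(1 / 4)] i * (x * y ^ 2)) := by
  have h4 : (4 : K) = 2 * 2 := by norm_num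
  constructor
  · rintro i (rfl | rfl) x y <;>
    · simp only [singularGram, cons_val, smul_sym3_add_smul_sym3, det_sym3, h4]
      field_simp
      ring
  · rintro i (rfl | rfl | rfl | rfl) x y <;>
    · simp only [singularGram, cons_val, smul_sym3_add_smul_sym3, det_sym3, h4]
      field_simp
      ring

/-- A binary cubic form with a triple root is not equivalent to one with a double root and a
simple root. -/
theorem not_cube_eq_double {α β γ δ k m : K} (hM : α * δ - β * γ ≠ 0)
    (hk : k ≠ 0) (h : ∀ x y : K, m * (x * y ^ 2) = k * (β * x + δ * y) ^ 3) : False := by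
  have hβ : β = 0 := by simpa [hk] using h 1 0
  have hδ : δ = 0 := by simpa [hk] using h 0 1
  simp [hβ, hδ] at hM

/-- An equivalence of binary cubic forms with a double root and a simple root preserves the
double root. -/
theorem double_root_preserved (h2 : (2 : K) ≠ 0) {α β γ δ k m : K} (hM : α * δ - β * γ ≠ 0)
    (hk : k ≠ 0)
    (h : ∀ x y : K, m * (x * y ^ 2) = k * ((α * x + γ * y) * (β * x + δ * y) ^ 2)) :
    β = 0 ∧ m = k * (α * δ ^ 2) := by
  have h10 : α = 0 ∨ β = 0 := by simpa [hk] using h 1 0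
  have h01 : γ = 0 ∨ δ = 0 := by simpa [hk] using h 0 1
  have h11 := h 1 1
  have h12 := h 1 (-1)
  have hβ : β = 0 := by
    by_contra hβ
    have hα := h10.resolve_right hβ
    subst hα
    have hγ : γ ≠ 0 := by
      rintro rfl
      simp at hM
    have hδ := h01.resolve_left hγ
    subst hδ
    have : 2 * (k * γ * β ^ 2) = 0 := by linear_combination h12 - h11
    simp [h2, hk, hγ, hβ] at this
  subst hβ
  have hδ : δ ≠ 0 := by
    rintro rfl
    simp at hM
  have hγ := h01.resolve_right hδ
  subst hγ
  exact ⟨rfl, by linear_combination h11⟩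

theorem not_pencilEquiv_singularGram (h2 : (2 : K) ≠ 0) {l : K} (hl : ¬ IsSquare l) {i j : Fin 6}
    (hij : i < j) : ¬ PencilEquiv (singularGram l i).1 (singularGram l i).2
      (singularGram l j).1 (singularGram l j).2 := by
  have hl0 : l ≠ 0 := by
    rintro rfl
    exact hl ⟨0, by simp⟩
  have h4 : (4 : K) ≠ 0 := by
    rw [show (4 : K) = 2 * 2 by norm_num]
    exact mul_ne_zero h2 h2
  intro h
  obtain ⟨α, β, γ, δ, D, hM, hD, ⟨g, hg⟩, hdet⟩ := h.det_pencil
  have hD2 : D ^ 2 ≠ 0 := pow_ne_zero 2 hD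
  obtain ⟨triple, double⟩ := det_pencil_singularGram h2 l
  have entry : β = 0 → ∀ a b, (singularGram l j).1 a b =
      α * (g * (singularGram l i).1 * gᵀ) a b := by
    intro hβ a b
    rw [hg, hβ, zero_smul, add_zero, Matrix.smul_apply, smul_eq_mul]
  have rank_one : β = 0 → (singularGram l i).1 = sym3 0 0 0 0 0 1 →
      (singularGram l j).1 1 1 * (singularGram l j).1 2 2 = (singularGram l j).1 1 2 ^ 2 := by
    intro hβ hi
    rw [entry hβ, entry hβ, entry hβ, hi]
    simp [sym3, Matrix.mul_apply, Fin.sum_univ_three]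
    ring
  have hcases : (i = 0 ∧ j = 1) ∨ ((i = 0 ∨ i = 1) ∧ j ∈ ({2, 3, 4, 5} : Set (Fin 6))) ∨
      (i ∈ ({2, 3, 4, 5} : Set (Fin 6)) ∧ j ∈ ({2, 3, 4, 5} : Set (Fin 6))) := by
    simp only [Set.mem_insert_iff, Set.mem_singleton_iff]
    clear * - hij
    revert i j
    decide
  rcases hcases with ⟨rfl, rfl⟩ | ⟨hi, hj⟩ | ⟨hi, hj⟩
  · have hβ : β = 0 := by
      have := hdet 1 0
      rw [triple 1 (by simp), triple 0 (by simp)] at this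
      simpa [hD, h4] using this
    have := rank_one hβ rfl
    simp [singularGram, sym3] at this
    exact pow_ne_zero 2 h2 this.symm
  · refine not_cube_eq_double (k := D ^ 2 * -(1 / 4)) (m := ![0, 0, -1, -l, -(1 / 4), -(1 / 4)] j)
      hM (by simp [hD, h4]) fun x y => ?_
    rw [← double j hj, hdet, triple i (by simpa using hi)]
    ring
  · have hk : (![0, 0, -1, -l, -(1 / 4), -(1 / 4)] : Fin 6 → K) i ≠ 0 := by
      rcases hi with rfl | rfl | rfl | rfl <;> simp [hl0, h4]
    obtain ⟨hβ, hm⟩ := double_root_preserved h2 hM (mul_ne_zero hD2 hk) fun x y => by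
      rw [← double j hj, hdet, double i hi]
      ring
    have double_line : (i = 2 ∨ i = 3) → ¬ (j = 4 ∨ j = 5) := by
      intro hi' hj'
      have := rank_one hβ (by rcases hi' with rfl | rfl <;> rfl)
      rcases hj' with rfl | rfl <;> simp [singularGram, sym3, hl0] at this
    have hcases : (i = 2 ∧ j = 3) ∨ ((i = 2 ∨ i = 3) ∧ (j = 4 ∨ j = 5)) ∨ (i = 4 ∧ j = 5) := by
      simp only [Set.mem_insert_iff, Set.mem_singleton_iff] at hi hj
      clear * - hij hi hj
      revert i j
      decide
    rcases hcases with ⟨rfl, rfl⟩ | ⟨hi', hj'⟩ | ⟨rfl, rfl⟩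
    · have e := entry hβ 2 2
      simp [singularGram, sym3, Matrix.mul_apply, Fin.sum_univ_three] at e hm
      have hg2 : g 2 2 ≠ 0 := by
        intro h0
        simp [h0] at e
      refine hl ⟨D * δ / g 2 2, ?_⟩
      field_simp
      linear_combination g 2 2 ^ 2 * hm - D ^ 2 * δ ^ 2 * e
    · exact double_line hi' hj'
    · have e11 := entry hβ 1 1
      have e12 := entry hβ 1 2
      have e22 := entry hβ 2 2
      simp [singularGram, sym3, Matrix.mul_apply, Fin.sum_univ_three,
        -zero_eq_mul] at e11 e12 e22
      refine hl ⟨α * (g 1 1 * g 2 2 - g 1 2 * g 2 1), ?_⟩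
      linear_combination -e22 - α * (g 2 1 ^ 2 - g 2 2 ^ 2) * e11 +
        α * (g 1 1 * g 2 1 - g 1 2 * g 2 2) * e12

theorem exists_sq_or_mul_sq {l : F} (hl : ¬ IsSquare l) (t : F) (ht : t ≠ 0) :
    ∃ s, s ≠ 0 ∧ (t = s ^ 2 ∨ t = l * s ^ 2) := by
  have hl0 : l ≠ 0 := by
    rintro rfl
    exact hl ⟨0, by simp⟩
  by_cases hs : IsSquare t
  · obtain ⟨s, rfl⟩ := hs
    exact ⟨s, left_ne_zero_of_mul ht, Or.inl (sq s).symm⟩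
  · have hlt : IsSquare (t * l) := by
      rw [← quadraticChar_one_iff_isSquare (mul_ne_zero ht hl0), map_mul,
        quadraticChar_neg_one_iff_not_isSquare.2 hl, quadraticChar_neg_one_iff_not_isSquare.2 hs]
      norm_num
    obtain ⟨r, hr⟩ := hlt
    have hr0 : r ≠ 0 := by
      rintro rfl
      simp [ht, hl0] at hr
    refine ⟨r / l, div_ne_zero hr0 hl0, Or.inr ?_⟩
    field_simp
    linear_combination hr

/-- classification of singular pairs of ternary quadratic forms. -/
theorem stmt17 (p : ℕ) [Fact p.Prime] [CharP F p] (hp : p ≠ 2) (l : F) (hl : ¬ IsSquare l)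
    (x : (Fin 6 → F) × (Fin 6 → F)) (hx : DiscPT x = 0) :
    let sixReps : Fin 6 → (Fin 6 → F) × (Fin 6 → F) :=
      ![(![0,0,0,0,0,1], ![0,0,1,1,0,0]), (![0,0,0,0,1,0], ![0,0,1,1,0,0]),
        (![0,0,0,0,0,1], ![1,0,0,-1,0,0]), (![0,0,0,0,0,1], ![1,0,0,-l,0,0]),
        (![0,0,0,1,0,-1], ![0,0,1,0,0,0]), (![0,0,0,1,0,-l], ![0,0,1,0,0,0])]
    (∃ B : Fin 6 → F, InOrbitPT x (0, B)) ∨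
    (∃ y : (Fin 6 → F) × (Fin 6 → F), InOrbitPT x y ∧
      y.1 0 = 0 ∧ y.1 1 = 0 ∧ y.1 3 = 0 ∧ y.2 0 = 0 ∧ y.2 1 = 0 ∧ y.2 3 = 0) ∨
    (∃ y : (Fin 6 → F) × (Fin 6 → F), InOrbitPT x y ∧
      y.1 0 = 0 ∧ y.1 1 = 0 ∧ y.1 2 = 0 ∧ y.2 0 = 0 ∧ y.2 1 = 0 ∧ y.2 2 = 0) ∨
    (∃! i : Fin 6, InOrbitPT (sixReps i) x) := by
  have h2 : (2 : F) ≠ 0 := by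
    intro h
    have hdvd : p ∣ 2 := (CharP.cast_eq_zero_iff F p 2).1 (by exact_mod_cast h)
    exact hp ((Nat.prime_dvd_prime_iff_eq Fact.out Nat.prime_two).1 hdvd)
  intro sixReps
  have gram_rep : ∀ i, gram3 (sixReps i).1 = (singularGram l i).1 ∧
      gram3 (sixReps i).2 = (singularGram l i).2 := fun i =>
    Prod.ext_iff.1 (gram3_singularRep l i)
  simp only [inOrbitPT_iff h2, gram_rep]
  obtain ⟨A, B, hAB, hdet, hmix⟩ := exists_pencilEquiv_double_root h2 (gram3 x.1) (gram3 x.2)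
    (discCubic_eq_zero_of_DiscPT h2 hx)
  obtain ⟨hA, hB⟩ := hAB.transpose_eq (gram3_transpose _) (gram3_transpose _)
  have symm_sym3 : ∀ a b c d e f : F, (sym3 a b c d e f)ᵀ = sym3 a b c d e f := by
    intro a b c d e f
    ext i j
    fin_cases i <;> fin_cases j <;> rfl
  rcases hAB.hasSingularForm (hasSingularForm_of_double_root h2 (exists_sq_or_mul_sq hl) hA hB
    hdet hmix) with ⟨B', h⟩ | ⟨c, e, f, c', e', f', h⟩ | ⟨d, e, f, d', e', f', h⟩ | ⟨i, h⟩
  · refine Or.inl ⟨formOfGram B', ?_⟩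
    obtain ⟨-, hB'⟩ := h.transpose_eq (gram3_transpose _) (gram3_transpose _)
    rw [gram3_formOfGram h2 hB']
    convert h using 1
    ext i j
    fin_cases i <;> fin_cases j <;> simp [gram3]
  · refine Or.inr (Or.inl ⟨(formOfGram (sym3 0 0 c 0 e f), formOfGram (sym3 0 0 c' 0 e' f')),
      ?_, ?_⟩)
    · simpa only [gram3_formOfGram h2 (symm_sym3 _ _ _ _ _ _)] using h
    · simp [formOfGram, sym3]
  · refine Or.inr (Or.inr (Or.inl ⟨(formOfGram (sym3 0 0 0 d e f),
      formOfGram (sym3 0 0 0 d' e' f')), ?_, ?_⟩))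
    · simpa only [gram3_formOfGram h2 (symm_sym3 _ _ _ _ _ _)] using h
    · simp [formOfGram, sym3]
  · refine Or.inr (Or.inr (Or.inr ⟨i, h.symm, fun j hj => ?_⟩))
    have hji := hj.trans h
    by_contra hne
    rcases lt_or_gt_of_ne hne with hlt | hlt
    · exact not_pencilEquiv_singularGram h2 hl hlt hji
    · exact not_pencilEquiv_singularGram h2 hl hlt hji.symm

end
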